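/- For every infinite-dimensional Banach space X, K_a(X) > 1. Equivalently, there exist an infinite subset S of the unit ball of X and a constant d > 1 such that for every pair of distinct x, y ∈ S there exists f in the dual unit ball with d ≤ f(x) - f(y) and f(y) ≤ f(z) ≤ f(x) for all z ∈ S. -/

import Mathlib

open Set Filter

noncomputable section

/-- `S` is a `(c₁, c₂, d)`-bounded and separated antipodal subset of `X`. -/
def IsBSA (X : Type*) [NormedAddCommGroup X] [NormedSpace ℝ X] (S : Set X)
    (c₁ c₂ d : ℝ) : Prop :=
  (∀ x ∈ S, ‖x‖ ≤ c₁) ∧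
  ∀ x ∈ S, ∀ y ∈ S, x ≠ y → ∃ f : X →L[ℝ] ℝ, ‖f‖ ≤ c₂ ∧ d ≤ f y - f x ∧
    ∀ z ∈ S, f x ≤ f z ∧ f z ≤ f y

/-- The antipodal Kottman constant `K_a(X)`. -/
def Ka (X : Type*) [NormedAddCommGroup X] [NormedSpace ℝ X] : ℝ :=
  sSup {d : ℝ | ∃ S : Set X, S.Infinite ∧ IsBSA X S 1 1 d}

/-- The Kottman (separation) constant `K(X)`. -/
def Kc (X : Type*) [NormedAddCommGroup X] : ℝ :=
  sSup {d : ℝ | ∃ S : Set X, S ⊆ Metric.closedBall 0 1 ∧ S.Infinite ∧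
    ∀ x ∈ S, ∀ y ∈ S, x ≠ y → d ≤ ‖x - y‖}

section

open scoped Finset Topology

open Classical in
/-- The part of `N` below `k`, as a finite set. -/
def initSeg (N : Set ℕ) (k : ℕ) : Finset ℕ := (Finset.range k).filter (· ∈ N)

theorem mem_initSeg {N : Set ℕ} {k i : ℕ} : i ∈ initSeg N k ↔ i < k ∧ i ∈ N := by
  simp [initSeg]

theorem initSeg_subset (N : Set ℕ) (k : ℕ) : (initSeg N k : Set ℕ) ⊆ N :=
  fun _ hi => (mem_initSeg.1 hi).2

theorem initSeg_initSeg (N : Set ℕ) (k l : ℕ) :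
    initSeg (initSeg N k) l = initSeg N (min k l) := by
  ext i; simp only [mem_initSeg, Finset.mem_coe]; grind

/-- The elements of `M` that lie strictly above every element of `s`. -/
def after (M : Set ℕ) (s : Finset ℕ) : Set ℕ := {m ∈ M | ∀ i ∈ s, i < m}

theorem after_subset (M : Set ℕ) (s : Finset ℕ) : after M s ⊆ M := fun _ h => h.1

theorem after_mono {M N : Set ℕ} (h : M ⊆ N) (s : Finset ℕ) : after M s ⊆ after N s :=
  fun _ hm => ⟨h hm.1, hm.2⟩

theorem infinite_after {M : Set ℕ} (hM : M.Infinite) (s : Finset ℕ) : (after M s).Infinite := by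
  refine (hM.sdiff (finite_Iic (s.sup id))).mono fun m hm => ⟨hm.1, fun i hi => ?_⟩
  exact (Finset.le_sup (f := id) hi).trans_lt (not_le.1 hm.2)

/-- Fusion: a step-by-step choice of elements and reservoirs can be diagonalised. -/
theorem exists_fusion (I : Finset ℕ → Set ℕ → Prop) {L : Set ℕ} (hL : L.Infinite) (h0 : I ∅ L)
    (step : ∀ s A, A.Infinite → A ⊆ L → I s A → ∃ z ∈ A, ∃ A' ⊆ A, A'.Infinite ∧
      (∀ a ∈ A', z < a) ∧ I (insert z s) A') :
    ∃ M ⊆ L, M.Infinite ∧ ∀ k, ∃ A ⊆ L, A.Infinite ∧ I (initSeg M k) A ∧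
      ∀ m ∈ M, k ≤ m → m ∈ A := by
  let St := {p : Finset ℕ × Set ℕ // p.2.Infinite ∧ p.2 ⊆ L ∧ I p.1 p.2}
  have hstep : ∀ p : St, ∃ z ∈ p.1.2, ∃ q : St, q.1.1 = insert z p.1.1 ∧ q.1.2 ⊆ p.1.2 ∧
      ∀ a ∈ q.1.2, z < a := by
    rintro ⟨⟨s, A⟩, hA, hAL, hI⟩
    obtain ⟨z, hz, A', hA', hinf, hlt, hI'⟩ := step s A hA hAL hI
    exact ⟨z, hz, ⟨⟨insert z s, A'⟩, hinf, hA'.trans hAL, hI'⟩, rfl, hA', hlt⟩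
  choose z hz nxt hn1 hn2 hn3 using hstep
  let q : ℕ → St := fun n => Nat.rec ⟨⟨∅, L⟩, hL, Subset.rfl, h0⟩ (fun _ p => nxt p) n
  have hq : ∀ n, q (n + 1) = nxt (q n) := fun n => rfl
  let m : ℕ → ℕ := fun n => z (q n)
  have hanti : ∀ n k, (q (n + k)).1.2 ⊆ (q n).1.2 := by
    intro n k
    induction k with
    | zero => exact Subset.rfl
    | succ k ih => rw [← add_assoc, hq]; exact (hn2 _).trans ih
  have hmem : ∀ n k, m (n + k) ∈ (q n).1.2 := fun n k => hanti n k (hz _)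
  have hmono : StrictMono m := by
    refine strictMono_nat_of_lt_succ fun n => ?_
    have := hmem (n + 1) 0
    rw [hq] at this
    exact hn3 _ _ this
  have hs : ∀ n, (q n).1.1 = (Finset.range n).image m := by
    intro n
    induction n with
    | zero => rfl
    | succ n ih => rw [hq, hn1, ih, Finset.range_add_one, Finset.image_insert]
  refine ⟨Set.range m, ?_, infinite_range_of_injective hmono.injective, fun k => ?_⟩
  · rintro _ ⟨n, rfl⟩
    exact (q n).2.2.1 (hz _)
  · have hex : ∃ n, k ≤ m n := ⟨k, hmono.id_le k⟩
    classical
    let n := Nat.find hex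
    have hn : ∀ j, k ≤ m j ↔ n ≤ j := fun j => ⟨fun h => Nat.find_min' hex h,
      fun h => (Nat.find_spec hex).trans (hmono.monotone h)⟩
    refine ⟨(q n).1.2, (q n).2.2.1, (q n).2.1, ?_, ?_⟩
    · have : initSeg (Set.range m) k = (q n).1.1 := by
        rw [hs]
        ext i
        simp only [mem_initSeg, Set.mem_range, Finset.mem_image, Finset.mem_range]
        constructor
        · rintro ⟨h, j, rfl⟩
          exact ⟨j, by have := hn j; omega, rfl⟩
        · rintro ⟨j, hj, rfl⟩
          exact ⟨by have := hn j; omega, j, rfl⟩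
      rw [this]
      exact (q n).2.2.2
    · rintro _ ⟨j, rfl⟩ hj
      obtain ⟨i, rfl⟩ := Nat.exists_eq_add_of_le ((hn j).1 hj)
      exact hmem n i

/-- Finitely many dense hereditary properties of infinite sets hold simultaneously. -/
theorem exists_forall_mem_finset {ι : Type*} (P : ι → Set ℕ → Prop)
    (hher : ∀ i A B, P i A → B ⊆ A → P i B)
    (hdense : ∀ i A, A.Infinite → ∃ B ⊆ A, B.Infinite ∧ P i B) (T : Finset ι) {A : Set ℕ}
    (hA : A.Infinite) : ∃ B ⊆ A, B.Infinite ∧ ∀ i ∈ T, P i B := by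
  classical
  induction T using Finset.induction_on with
  | empty => exact ⟨A, Subset.rfl, hA, by simp⟩
  | insert a T _ ih =>
    obtain ⟨B, hBA, hB, h⟩ := ih
    obtain ⟨C, hCB, hC, h'⟩ := hdense a B hB
    refine ⟨C, hCB.trans hBA, hC, fun i hi => ?_⟩
    rcases Finset.mem_insert.1 hi with rfl | hi
    · exact h'
    · exact hher _ _ _ (h i hi) hCB

/-- Diagonalisation of dense hereditary properties indexed by finite sets. -/
theorem exists_diagonal (P : Finset ℕ → Set ℕ → Prop) (hher : ∀ s A B, P s A → B ⊆ A → P s B)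
    (hdense : ∀ s A, A.Infinite → ∃ B ⊆ A, B.Infinite ∧ P s B) {L : Set ℕ} (hL : L.Infinite) :
    ∃ M ⊆ L, M.Infinite ∧ ∀ s : Finset ℕ, (s : Set ℕ) ⊆ M → P s (after M s) := by
  obtain ⟨L', hL'L, hL', h0⟩ := hdense ∅ L hL
  obtain ⟨M, hML, hM, h⟩ := exists_fusion (fun s A => ∀ t ⊆ s, P t A) hL'
    (by simpa using h0) (by
      intro s A hA _ _
      obtain ⟨z, hz⟩ := hA.nonempty
      obtain ⟨B, hBA, hB, hP⟩ := exists_forall_mem_finset P hher hdense (insert z s).powerset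
        (infinite_after hA {z})
      exact ⟨z, hz, B, hBA.trans (after_subset _ _), hB, fun a ha => (hBA ha).2 z (by simp),
        fun t ht => hP t (by simpa using ht)⟩)
  refine ⟨M, hML.trans hL'L, hM, fun s hs => ?_⟩
  obtain ⟨A, -, -, hI, hA⟩ := h (s.sup (· + 1))
  refine hher _ _ _ (hI s fun i hi => mem_initSeg.2 ⟨?_, hs hi⟩) fun m hm => hA m hm.1 ?_
  · exact Nat.lt_of_succ_le (Finset.le_sup (f := (· + 1)) hi)
  · exact Finset.sup_le fun i hi => hm.2 i hi

/-- Galvin's lemma: a family of finite sets is either avoided by all finite subsets of some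
infinite set or met by the initial segments of all its infinite subsets. -/
theorem exists_galvin (𝓕 : Set (Finset ℕ)) {L : Set ℕ} (hL : L.Infinite) :
    ∃ M ⊆ L, M.Infinite ∧ ((∀ F : Finset ℕ, (F : Set ℕ) ⊆ M → F ∉ 𝓕) ∨
      ∀ N ⊆ M, N.Infinite → ∃ k, initSeg N k ∈ 𝓕) := by
  let acc : Set ℕ → Finset ℕ → Prop := fun A s =>
    ∀ N ⊆ A, N.Infinite → (∀ n ∈ N, ∀ i ∈ s, i < n) → ∃ k, initSeg (s ∪ N) k ∈ 𝓕
  let rej : Set ℕ → Finset ℕ → Prop := fun A s => ∀ B ⊆ A, B.Infinite → ¬ acc B s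
  obtain ⟨M, hML, hM, hdec⟩ := exists_diagonal (fun s A => acc A s ∨ rej A s)
    (by
      rintro s A B (h | h) hBA
      · exact .inl fun N hN => h N (hN.trans hBA)
      · exact .inr fun C hC => h C (hC.trans hBA))
    (by
      intro s A hA
      by_cases h : rej A s
      · exact ⟨A, Subset.rfl, hA, .inr h⟩
      · simp only [rej, not_forall, not_not] at h
        obtain ⟨B, hBA, hB, h⟩ := h
        exact ⟨B, hBA, hB, .inl h⟩) hL
  have hdec' : ∀ s : Finset ℕ, (s : Set ℕ) ⊆ M → acc M s ∨ rej M s := by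
    intro s hs
    rcases hdec s hs with h | h
    · exact .inl fun N hN hN' hlt => h N (fun n hn => ⟨hN hn, hlt n hn⟩) hN' hlt
    · exact .inr fun B hB hB' hacc => h _ (after_mono hB s) (infinite_after hB' s)
        fun N hN => hacc N (hN.trans (after_subset _ _))
  rcases hdec' ∅ (by simp) with h | h
  · exact ⟨M, hML, hM, .inr fun N hN hN' => by simpa using h N hN hN' (by simp)⟩
  obtain ⟨M', hM'M, hM', h'⟩ := exists_fusion (fun s _ => (s : Set ℕ) ⊆ M ∧ ∀ t ⊆ s, rej M t) hM
    (by simpa using h) (by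
      rintro s A hA hAM ⟨hsM, hs⟩
      have hfin : ∀ t ∈ s.powerset, {z ∈ after A s | acc M (insert z t)}.Finite := by
        intro t ht
        by_contra hinf
        refine hs t (Finset.mem_powerset.1 ht) _
          ((sep_subset _ _).trans ((after_subset _ _).trans hAM)) hinf fun N hN hNinf hlt => ?_
        classical
        let z := sInf N
        have hz : z ∈ N := Nat.sInf_mem hNinf.nonempty
        obtain ⟨k, hk⟩ := (hN hz).2 (N \ {z})
          (sdiff_subset.trans (hN.trans ((sep_subset _ _).trans ((after_subset _ _).trans hAM))))
          (hNinf.sdiff (finite_singleton z)) (by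
            intro n hn i hi
            rcases Finset.mem_insert.1 hi with rfl | hi
            · exact lt_of_le_of_ne (Nat.sInf_le hn.1) (fun h => hn.2 h.symm)
            · exact hlt n hn.1 i hi)
        refine ⟨k, ?_⟩
        convert hk using 2
        ext i
        simp only [mem_union, Finset.coe_insert, mem_insert_iff, Set.mem_sdiff, mem_singleton_iff]
        grind
      have hbad := (Finset.finite_toSet s.powerset).biUnion hfin
      obtain ⟨z, hz, hzg⟩ := ((infinite_after hA s).sdiff hbad).nonempty
      simp only [mem_iUnion, not_exists] at hzg
      have hsz : ((insert z s : Finset ℕ) : Set ℕ) ⊆ M := by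
        rw [Finset.coe_insert]
        exact insert_subset (hAM hz.1) hsM
      refine ⟨z, hz.1, after A {z}, after_subset _ _, infinite_after hA _,
        fun a ha => ha.2 z (by simp), hsz, fun t ht => ?_⟩
      by_cases hzt : z ∈ t
      · have hts : t.erase z ⊆ s := by
          intro i hi
          have := ht (Finset.mem_of_mem_erase hi)
          have := Finset.ne_of_mem_erase hi
          grind
        refine (hdec' t (fun i hi => hsz (ht hi))).resolve_left fun hacc => ?_
        refine hzg (t.erase z) (Finset.mem_coe.2 (Finset.mem_powerset.2 hts)) ⟨hz, ?_⟩
        rwa [Finset.insert_erase hzt]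
      · exact hs t ((Finset.subset_insert_iff_of_notMem hzt).1 ht))
  refine ⟨M', hM'M.trans hML, hM', .inl fun F hF hF𝓕 => ?_⟩
  obtain ⟨A, -, -, ⟨-, hI⟩, -⟩ := h' (F.sup (· + 1))
  have hlt : ∀ i ∈ F, i < F.sup (· + 1) := fun i hi =>
    Nat.lt_of_succ_le (Finset.le_sup (f := (· + 1)) hi)
  refine hI F (fun i hi => mem_initSeg.2 ⟨hlt i hi, hF hi⟩) M Subset.rfl hM
    fun N _ _ hN => ⟨F.sup (· + 1), ?_⟩
  convert hF𝓕
  ext i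
  simp only [mem_initSeg, mem_union, Finset.mem_coe]
  refine ⟨?_, fun hi => ⟨hlt i hi, .inl hi⟩⟩
  rintro ⟨h1, h2 | h2⟩
  · exact h2
  · exact absurd h1 (not_lt.2 (Finset.sup_le fun j hj => hN i h2 j hj))

variable {X : Type*} [NormedAddCommGroup X] [NormedSpace ℝ X]

/-- The space contains an infinite antipodal subset of its unit ball with separation beyond `1`. -/
def HasAntipodal (X : Type*) [NormedAddCommGroup X] [NormedSpace ℝ X] : Prop :=
  ∃ S : Set X, S.Infinite ∧ ∃ d : ℝ, 1 < d ∧ IsBSA X S 1 1 d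

theorem abs_apply_le {f : X →L[ℝ] ℝ} (hf : ‖f‖ ≤ 1) (x : X) : |f x| ≤ ‖x‖ := by
  simpa using f.le_of_opNorm_le hf x

theorem HasAntipodal.of_seq {u : ℕ → X} {c D : ℝ} (hcD : c < D) (hu : ∀ n, ‖u n‖ ≤ c)
    (h : ∀ n m, n < m → ∃ f : X →L[ℝ] ℝ, ‖f‖ ≤ 1 ∧ D ≤ f (u n) - f (u m) ∧
      ∀ z, f (u m) ≤ f (u z) ∧ f (u z) ≤ f (u n)) : HasAntipodal X := by
  have hc0 : 0 ≤ c := (norm_nonneg _).trans (hu 0)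
  have hc : 0 < c := by
    refine hc0.lt_of_ne fun h0 => ?_
    obtain ⟨f, -, hD, -⟩ := h 0 1 one_pos
    have hu0 : ∀ n, u n = 0 := fun n => norm_le_zero_iff.1 (h0 ▸ hu n)
    simp only [hu0, map_zero, sub_zero] at hD
    linarith
  have hne : ∀ n m, n < m → u n ≠ u m := by
    intro n m hnm he
    obtain ⟨f, -, hD, -⟩ := h n m hnm
    rw [he, sub_self] at hD
    linarith
  have hinj : Function.Injective fun n => c⁻¹ • u n := by
    intro n m he
    have he' : u n = u m := smul_right_injective X (inv_ne_zero hc.ne') he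
    rcases lt_trichotomy n m with hlt | rfl | hlt
    · exact absurd he' (hne _ _ hlt)
    · rfl
    · exact absurd he'.symm (hne _ _ hlt)
  refine ⟨Set.range fun n => c⁻¹ • u n, infinite_range_of_injective hinj, D / c,
    (one_lt_div hc).2 hcD, ?_, ?_⟩
  · rintro _ ⟨n, rfl⟩
    rw [norm_smul, norm_inv, Real.norm_of_nonneg hc0, inv_mul_le_one₀ hc]
    exact hu n
  · rintro _ ⟨n, rfl⟩ _ ⟨m, rfl⟩ hnm
    have hi : 0 ≤ c⁻¹ := inv_nonneg.2 hc0
    simp only [Set.forall_mem_range, map_smul, smul_eq_mul, div_eq_inv_mul, ← mul_sub]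
    have key : ∀ f : X →L[ℝ] ℝ, (D ≤ f (u m) - f (u n) ∧
        ∀ z, f (u n) ≤ f (u z) ∧ f (u z) ≤ f (u m)) →
        c⁻¹ * D ≤ c⁻¹ * (f (u m) - f (u n)) ∧
        ∀ z, c⁻¹ * f (u n) ≤ c⁻¹ * f (u z) ∧ c⁻¹ * f (u z) ≤ c⁻¹ * f (u m) :=
      fun f hf => ⟨mul_le_mul_of_nonneg_left hf.1 hi, fun z =>
        ⟨mul_le_mul_of_nonneg_left (hf.2 z).1 hi, mul_le_mul_of_nonneg_left (hf.2 z).2 hi⟩⟩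
    rcases lt_trichotomy n m with hlt | rfl | hlt
    · obtain ⟨f, hf, hD, hz⟩ := h n m hlt
      refine ⟨-f, by simpa using hf, key (-f) ⟨by simp; linarith, fun z => ?_⟩⟩
      simpa using (hz z).symm
    · exact absurd rfl hnm
    · obtain ⟨f, hf, hD, hz⟩ := h m n hlt
      exact ⟨f, hf, key f ⟨hD, hz⟩⟩

theorem HasAntipodal.one_lt_Ka (h : HasAntipodal X) : 1 < Ka X := by
  obtain ⟨S, hS, d, hd, hB⟩ := h
  refine hd.trans_le (le_csSup ⟨2, ?_⟩ ⟨S, hS, hB⟩)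
  rintro e ⟨T, hT, hT1, hT2⟩
  obtain ⟨x, hx, y, hy, hxy⟩ := hT.nontrivial
  obtain ⟨f, hf, he, -⟩ := hT2 x hx y hy hxy
  have h1 := abs_le.1 ((abs_apply_le hf x).trans (hT1 x hx))
  have h2 := abs_le.1 ((abs_apply_le hf y).trans (hT1 y hy))
  linarith [h1.1, h2.2]

/-- Functionals in the unit ball converge pointwise along an ultrafilter. -/
theorem exists_dual_limit {ι : Type*} (𝓤 : Ultrafilter ι) (f : ι → X →L[ℝ] ℝ)
    (hf : ∀ i, ‖f i‖ ≤ 1) :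
    ∃ g : X →L[ℝ] ℝ, ‖g‖ ≤ 1 ∧ ∀ x, Tendsto (fun i => f i x) 𝓤 (𝓝 (g x)) := by
  obtain ⟨g, hg, hlim⟩ := (WeakDual.isCompact_closedBall (𝕜 := ℝ) (E := X) 0 1).ultrafilter_le_nhds'
    (𝓤.map fun i => StrongDual.toWeakDual (f i))
    (Eventually.of_forall (f := (𝓤 : Filter ι)) fun i => by simpa using hf i)
  refine ⟨WeakDual.toStrongDual g, by simpa using hg, fun x => ?_⟩
  exact ((WeakDual.eval_continuous x).tendsto g).comp (show Tendsto _ _ _ from hlim)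

/-- Prescribing the values of a norm-one functional on a sequence. -/
theorem exists_dual_of_le (z : ℕ → X) (φ : (ℕ →₀ ℝ) →ₗ[ℝ] ℝ)
    (hφ : ∀ a, |φ a| ≤ ‖Finsupp.linearCombination ℝ z a‖) :
    ∃ f : X →L[ℝ] ℝ, ‖f‖ ≤ 1 ∧ ∀ i, f (z i) = φ (Finsupp.single i 1) := by
  let T := Finsupp.linearCombination ℝ z
  have hker : ∀ a, T a = 0 → φ a = 0 := fun a ha => by
    have := hφ a
    rw [show Finsupp.linearCombination ℝ z a = 0 from ha, norm_zero] at this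
    exact abs_nonpos_iff.1 this
  let ψ : LinearMap.range T →ₗ[ℝ] ℝ :=
    ((LinearMap.ker T).liftQ φ fun a ha => hker a ha) ∘ₗ T.quotKerEquivRange.symm.toLinearMap
  have hψ : ∀ a, ψ ⟨T a, a, rfl⟩ = φ a := by
    intro a
    have : T.quotKerEquivRange.symm ⟨T a, a, rfl⟩ = (LinearMap.ker T).mkQ a := by
      rw [LinearEquiv.symm_apply_eq]
      ext
      simp
    simp only [ψ, LinearMap.comp_apply, LinearEquiv.coe_coe, this]
    exact Submodule.liftQ_apply _ _ _
  obtain ⟨g, hg, hgn⟩ := exists_extension_norm_eq (LinearMap.range T)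
    (ψ.mkContinuous 1 (by
      rintro ⟨_, a, rfl⟩
      rw [hψ, one_mul]
      exact hφ a))
  refine ⟨g, hgn.trans_le (LinearMap.mkContinuous_norm_le _ zero_le_one _), fun i => ?_⟩
  have h1 : T (Finsupp.single i 1) = z i := by simp [T]
  have := hg ⟨T (Finsupp.single i 1), _, rfl⟩
  rw [LinearMap.mkContinuous_apply, hψ] at this
  rw [← this, ← h1]

/-- Successive blocks with a property that is available arbitrarily far out. -/
theorem exists_blocks (p : (ℕ →₀ ℝ) → Prop) (N₀ : ℕ)
    (h : ∀ N, N₀ ≤ N → ∃ a : ℕ →₀ ℝ, (∀ i < N, a i = 0) ∧ p a) :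
    ∃ a : ℕ → ℕ →₀ ℝ, (∀ n, (∀ i < N₀, a n i = 0) ∧ p (a n)) ∧
      ∀ n m i, n ≠ m → a n i ≠ 0 → a m i = 0 := by
  obtain ⟨a, ha, hr⟩ := exists_seq_of_forall_finset_exists
    (fun a : ℕ →₀ ℝ => (∀ i < N₀, a i = 0) ∧ p a)
    (fun a b => ∀ i, a i ≠ 0 → b i = 0) (by
      intro s _
      obtain ⟨b, hb, hp⟩ := h (max N₀ (s.sup fun a => a.support.sup (· + 1))) (le_max_left _ _)
      refine ⟨b, ⟨fun i hi => hb i (hi.trans_le (le_max_left _ _)), hp⟩, fun a ha i hi => hb i ?_⟩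
      refine lt_of_lt_of_le ?_ (le_max_right _ _)
      refine lt_of_lt_of_le ?_ (Finset.le_sup (f := fun a : ℕ →₀ ℝ => a.support.sup (· + 1)) ha)
      exact Nat.lt_of_succ_le (Finset.le_sup (f := (· + 1)) (Finsupp.mem_support_iff.2 hi)))
  refine ⟨a, ha, fun n m i hnm hi => ?_⟩
  rcases hnm.lt_or_gt with hlt | hlt
  · exact hr n m hlt i hi
  · by_contra h0
    exact hi (hr m n hlt i h0)

/-- The coefficients of a combination of disjointly supported blocks. -/
theorem linearCombination_apply_of_disjoint {a : ℕ → ℕ →₀ ℝ}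
    (hdisj : ∀ n m i, n ≠ m → a n i ≠ 0 → a m i = 0) (c : ℕ →₀ ℝ) {n i : ℕ} (hi : a n i ≠ 0) :
    Finsupp.linearCombination ℝ a c i = c n * a n i := by
  rw [Finsupp.linearCombination_apply, Finsupp.sum, Finsupp.finsetSum_apply,
    Finset.sum_eq_single n]
  · simp
  · intro m _ hmn
    simp [hdisj n m i hmn.symm hi]
  · intro hn
    simp [Finsupp.notMem_support_iff.1 hn]

theorem linearCombination_blocks (w : ℕ → X) (a : ℕ → ℕ →₀ ℝ) (c : ℕ →₀ ℝ) :
    Finsupp.linearCombination ℝ (fun n => Finsupp.linearCombination ℝ w (a n)) c =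
      Finsupp.linearCombination ℝ w (Finsupp.linearCombination ℝ a c) := by
  exact (Finsupp.apply_linearCombination ℝ (Finsupp.linearCombination ℝ w) a c).symm

theorem linearCombination_apply_eq_zero {a : ℕ → ℕ →₀ ℝ} (c : ℕ →₀ ℝ) {i : ℕ}
    (hi : ∀ n, a n i = 0) : Finsupp.linearCombination ℝ a c i = 0 := by
  rw [Finsupp.linearCombination_apply, Finsupp.sum, Finsupp.finsetSum_apply]
  simp [hi]

/-- A bounded sequence equivalent to the unit vector basis of `ℓ₁` yields an antipodal set. -/
theorem HasAntipodal.of_l1 {w : ℕ → X} {R δ : ℝ} (hR : ∀ n, ‖w n‖ ≤ R) (hδ : 0 < δ)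
    (h : ∀ (a : ℕ →₀ ℝ) (F : Finset ℕ), δ * ∑ i ∈ F, |a i| ≤ ‖Finsupp.linearCombination ℝ w a‖) :
    HasAntipodal X := by
  let B : Set ℝ := {b | ∃ N, ∀ a : ℕ →₀ ℝ, (∀ i < N, a i = 0) → ∀ F : Finset ℕ,
    b * ∑ i ∈ F, |a i| ≤ ‖Finsupp.linearCombination ℝ w a‖}
  have hδB : δ ∈ B := ⟨0, fun a _ F => h a F⟩
  have hB : BddAbove B := by
    refine ⟨R, ?_⟩
    rintro b ⟨N, hN⟩
    have := hN (Finsupp.single N 1) (fun i hi => by simp [hi.ne']) {N}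
    simp only [Finset.sum_singleton, Finsupp.single_eq_same, abs_one, mul_one,
      Finsupp.linearCombination_single, one_smul] at this
    exact this.trans (hR N)
  set s := sSup B with hs
  have hs0 : 0 < s := hδ.trans_le (le_csSup hB hδB)
  obtain ⟨b, ⟨N₀, hb⟩, hsb⟩ := exists_lt_of_lt_csSup ⟨δ, hδB⟩ (show 9 / 10 * s < sSup B by linarith)
  have hns : 11 / 10 * s ∉ B := fun hmem => by linarith [le_csSup hB hmem]
  obtain ⟨a, ha, hdisj⟩ := exists_blocks (fun a => (∃ F : Finset ℕ, ∑ i ∈ F, |a i| = 1) ∧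
    ‖Finsupp.linearCombination ℝ w a‖ ≤ 11 / 10 * s) N₀ (by
      intro N _
      have : ¬ ∀ a : ℕ →₀ ℝ, (∀ i < N, a i = 0) → ∀ F : Finset ℕ,
          11 / 10 * s * ∑ i ∈ F, |a i| ≤ ‖Finsupp.linearCombination ℝ w a‖ :=
        fun hall => hns ⟨N, hall⟩
      push Not at this
      obtain ⟨a, haN, F, hF⟩ := this
      have hσ : 0 < ∑ i ∈ F, |a i| := by
        by_contra hle
        have : 11 / 10 * s * ∑ i ∈ F, |a i| ≤ 0 :=
          mul_nonpos_of_nonneg_of_nonpos (by linarith) (not_lt.1 hle)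
        linarith [norm_nonneg (Finsupp.linearCombination ℝ w a)]
      set σ := ∑ i ∈ F, |a i|
      refine ⟨σ⁻¹ • a, fun i hi => by simp [haN i hi], ⟨F, ?_⟩, ?_⟩
      · simp only [Finsupp.smul_apply, smul_eq_mul, abs_mul, ← Finset.mul_sum,
          abs_of_pos (inv_pos.2 hσ)]
        exact inv_mul_cancel₀ hσ.ne'
      · rw [map_smul, norm_smul, Real.norm_of_nonneg (inv_pos.2 hσ).le, inv_mul_le_iff₀ hσ]
        linarith)
  refine HasAntipodal.of_seq (u := fun n => Finsupp.linearCombination ℝ w (a n))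
    (show 11 / 10 * s < 2 * b by linarith) (fun n => (ha n).2.2) fun n m hnm => ?_
  obtain ⟨F, hF⟩ := (ha n).2.1
  obtain ⟨G, hG⟩ := (ha m).2.1
  have hb0 : 0 ≤ b := by linarith
  obtain ⟨f, hf, hfz⟩ := exists_dual_of_le (fun n => Finsupp.linearCombination ℝ w (a n))
    (b • (Finsupp.lapply n - Finsupp.lapply m)) (by
      intro c
      rw [linearCombination_blocks]
      have key := hb (Finsupp.linearCombination ℝ a c)
        (fun i hi => linearCombination_apply_eq_zero c fun n => (ha n).1 i hi)
        (F.filter (fun i => a n i ≠ 0) ∪ G.filter (fun i => a m i ≠ 0))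
      have hsum : ∀ k (H : Finset ℕ), ∑ i ∈ H, |a k i| = 1 →
          ∑ i ∈ H.filter (fun i => a k i ≠ 0), |Finsupp.linearCombination ℝ a c i| = |c k| := by
        intro k H hH
        calc _ = ∑ i ∈ H.filter (fun i => a k i ≠ 0), |c k| * |a k i| := by
              refine Finset.sum_congr rfl fun i hi => ?_
              rw [linearCombination_apply_of_disjoint hdisj c (Finset.mem_filter.1 hi).2, abs_mul]
          _ = |c k| * ∑ i ∈ H, |a k i| := by
              rw [← Finset.mul_sum, Finset.sum_filter_of_ne]
              intro i _ hi
              simpa using hi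
          _ = |c k| := by rw [hH, mul_one]
      rw [Finset.sum_union, hsum n F hF, hsum m G hG] at key
      · refine le_trans ?_ key
        simp only [LinearMap.smul_apply, LinearMap.sub_apply, Finsupp.lapply_apply, smul_eq_mul,
          abs_mul, abs_of_nonneg hb0]
        exact mul_le_mul_of_nonneg_left (abs_sub _ _) hb0
      · rw [Finset.disjoint_left]
        intro i hi hi'
        exact (Finset.mem_filter.1 hi').2 (hdisj n m i hnm.ne (Finset.mem_filter.1 hi).2))
  have hv : ∀ k, f (Finsupp.linearCombination ℝ w (a k)) =
      b * ((if k = n then 1 else 0) - if k = m then 1 else 0) := by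
    intro k
    rw [hfz]
    simp [Finsupp.single_apply]
  refine ⟨f, hf, ?_, fun k => ?_⟩
  · simp only [hv, hnm.ne, hnm.ne', if_true, if_false]
    linarith
  · simp only [hv, hnm.ne, hnm.ne', if_true, if_false]
    constructor <;> split_ifs <;> nlinarith

/-- A seminormalised sequence whose bounded combinations stay bounded, that is, a `c₀` sequence,
yields an antipodal set. -/
theorem HasAntipodal.of_c0 {y : ℕ → X} {K δ : ℝ} (hδ : 0 < δ) (hy : ∀ n, δ ≤ ‖y n‖)
    (h : ∀ a : ℕ →₀ ℝ, (∀ i, |a i| ≤ 1) → ‖Finsupp.linearCombination ℝ y a‖ ≤ K) :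
    HasAntipodal X := by
  let B : Set ℝ := {b | ∃ N, ∀ a : ℕ →₀ ℝ, (∀ i < N, a i = 0) → (∀ i, |a i| ≤ 1) →
    ‖Finsupp.linearCombination ℝ y a‖ ≤ b}
  have hKB : K ∈ B := ⟨0, fun a _ => h a⟩
  have hBδ : δ ∈ lowerBounds B := by
    rintro b ⟨N, hN⟩
    have := hN (Finsupp.single N 1) (fun i hi => by simp [hi.ne']) (fun i => by
      rw [Finsupp.single_apply]; split_ifs <;> simp)
    simp only [Finsupp.linearCombination_single, one_smul] at this
    exact (hy N).trans this
  have hB : BddBelow B := ⟨δ, hBδ⟩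
  set s := sInf B with hs
  have hs0 : 0 < s := hδ.trans_le (le_csInf ⟨K, hKB⟩ hBδ)
  obtain ⟨b, ⟨N₀, hb⟩, hsb⟩ := exists_lt_of_csInf_lt ⟨K, hKB⟩ (show sInf B < 11 / 10 * s by linarith)
  have hns : 9 / 10 * s ∉ B := fun hmem => by linarith [csInf_le hB hmem]
  obtain ⟨a, ha, hdisj⟩ := exists_blocks (fun a => (∀ i, |a i| ≤ 1) ∧
    9 / 10 * s ≤ ‖Finsupp.linearCombination ℝ y a‖) N₀ (by
      intro N _
      have : ¬ ∀ a : ℕ →₀ ℝ, (∀ i < N, a i = 0) → (∀ i, |a i| ≤ 1) →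
          ‖Finsupp.linearCombination ℝ y a‖ ≤ 9 / 10 * s := fun hall => hns ⟨N, hall⟩
      push Not at this
      obtain ⟨a, haN, ha1, hlt⟩ := this
      exact ⟨a, haN, ha1, hlt.le⟩)
  set z : ℕ → X := fun n => Finsupp.linearCombination ℝ y (a n) with hz
  have hup : ∀ c : ℕ →₀ ℝ, (∀ k, |c k| ≤ 1) → ‖Finsupp.linearCombination ℝ z c‖ ≤ b := by
    intro c hc
    rw [hz, linearCombination_blocks]
    refine hb _ (fun i hi => linearCombination_apply_eq_zero c fun n => (ha n).1 i hi) fun i => ?_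
    by_cases hi : ∀ n, a n i = 0
    · rw [linearCombination_apply_eq_zero c hi]
      simp
    · push Not at hi
      obtain ⟨n, hn⟩ := hi
      rw [linearCombination_apply_of_disjoint hdisj c hn, abs_mul]
      exact mul_le_one₀ (hc n) (abs_nonneg _) ((ha n).2.1 i)
  have hlow1 : ∀ (c : ℕ →₀ ℝ) k, (∀ j, |c j| ≤ 1) → |c k| = 1 →
      7 / 10 * s ≤ ‖Finsupp.linearCombination ℝ z c‖ := by
    intro c k hc hck
    have h1 := hup (Finsupp.single k (2 * c k) - c) (by
      intro j
      rw [Finsupp.sub_apply, Finsupp.single_apply]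
      split_ifs with hj
      · subst hj
        rw [two_mul, add_sub_cancel_right]
        exact hc k
      · rw [zero_sub, abs_neg]
        exact hc j)
    rw [map_sub, Finsupp.linearCombination_single] at h1
    have h2 : ‖(2 * c k) • z k‖ = 2 * ‖z k‖ := by
      rw [norm_smul, Real.norm_eq_abs, abs_mul, hck]
      norm_num
    have h3 := norm_sub_norm_le ((2 * c k) • z k) (Finsupp.linearCombination ℝ z c)
    have h4 : 9 / 10 * s ≤ ‖z k‖ := (ha k).2.2
    linarith
  have hlow : ∀ (c : ℕ →₀ ℝ) k, 7 / 10 * s * |c k| ≤ ‖Finsupp.linearCombination ℝ z c‖ := by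
    intro c k
    by_cases hck : c k = 0
    · simp [hck]
    obtain ⟨k₀, hk₀, hmax⟩ := c.support.exists_max_image (fun j => |c j|)
      ⟨k, Finsupp.mem_support_iff.2 hck⟩
    have hpos : 0 < |c k₀| := abs_pos.2 (Finsupp.mem_support_iff.1 hk₀)
    have hle : ∀ j, |c j| ≤ |c k₀| := by
      intro j
      by_cases hj : c j = 0
      · simp [hj]
      · exact hmax j (Finsupp.mem_support_iff.2 hj)
    have := hlow1 (|c k₀|⁻¹ • c) k₀ (by
      intro j
      rw [Finsupp.smul_apply, smul_eq_mul, abs_mul, abs_inv, abs_abs, inv_mul_le_one₀ hpos]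
      exact hle j) (by
      rw [Finsupp.smul_apply, smul_eq_mul, abs_mul, abs_inv, abs_abs, inv_mul_cancel₀ hpos.ne'])
    rw [map_smul, norm_smul, Real.norm_of_nonneg (inv_pos.2 hpos).le, le_inv_mul_iff₀ hpos] at this
    have h1 : 7 / 10 * s * |c k| ≤ 7 / 10 * s * |c k₀| :=
      mul_le_mul_of_nonneg_left (hle k) (by linarith)
    linarith
  let e : ℕ → ℕ →₀ ℝ := fun n => (∑ i ∈ Finset.range (n + 1), Finsupp.single i 1) -
    Finsupp.single (n + 1) 1
  have hcoef : ∀ n i, e n i = (if i < n + 1 then 1 else 0) - if i = n + 1 then 1 else 0 := by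
    intro n i
    simp [e, Finsupp.sub_apply, Finsupp.finsetSum_apply, Finsupp.single_apply, eq_comm]
  refine HasAntipodal.of_seq (u := fun n => Finsupp.linearCombination ℝ z (e n))
    (show b < 14 / 10 * s by linarith) (fun n => hup _ fun i => ?_) fun n m hnm => ?_
  · rw [hcoef]
    split_ifs <;> simp
  · obtain ⟨f, hf, hfz⟩ := exists_dual_of_le z ((-(7 / 10 * s)) • Finsupp.lapply (n + 1)) (by
      intro c
      simpa [abs_mul, abs_of_pos hs0, abs_of_pos (show (0 : ℝ) < 7 / 10 by norm_num)] using hlow c (n + 1))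
    have hf' : ∀ c, f (Finsupp.linearCombination ℝ z c) = -(7 / 10 * s) * c (n + 1) := by
      intro c
      have : f.toLinearMap ∘ₗ Finsupp.linearCombination ℝ z =
          (-(7 / 10 * s)) • Finsupp.lapply (n + 1) := by
        ext i
        simp [hfz]
      exact congrArg (fun g : (ℕ →₀ ℝ) →ₗ[ℝ] ℝ => g c) this
    refine ⟨f, hf, ?_, fun k => ?_⟩
    · simp only [hf', hcoef]
      split_ifs <;> first | omega | linarith
    · simp only [hf', hcoef]
      constructor <;> split_ifs <;> first | omega | linarith

theorem exists_strictMono_mem {M : Set ℕ} (hM : M.Infinite) :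
    ∃ φ : ℕ → ℕ, StrictMono φ ∧ ∀ n, φ n ∈ M :=
  Nat.exists_strictMono_subsequence fun N => (hM.exists_gt N).imp fun _ h => ⟨h.2, h.1⟩

/-- Finite subsets of a sequence in which chosen elements have ranks of prescribed parity. -/
theorem exists_finset_rank_parity {m : ℕ → ℕ} (hm : StrictMono m) (σ : ℕ → Prop) (n : ℕ) :
    ∃ F : Finset ℕ, (F : Set ℕ) ⊆ Set.range m ∧ (∀ i ∈ F, i < m (3 * n)) ∧ #F = 2 * n ∧
      ∀ i < n, m (3 * i + 1) ∈ F ∧ (Even #(F.filter (· < m (3 * i + 1))) ↔ σ i) := by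
  classical
  induction n with
  | zero => exact ⟨∅, by simp⟩
  | succ n ih =>
    obtain ⟨F, hFm, hFlt, hFc, hF⟩ := ih
    have ext : ∀ p q : ℕ, m (3 * n) ≤ m p → p < q → q < 3 * (n + 1) →
        (p = 3 * n + 1 ∨ q = 3 * n + 1) → ((p = 3 * n + 1) ↔ σ n) →
        ∃ G : Finset ℕ, (G : Set ℕ) ⊆ Set.range m ∧ (∀ i ∈ G, i < m (3 * (n + 1))) ∧
          #G = 2 * (n + 1) ∧ ∀ i < n + 1, m (3 * i + 1) ∈ G ∧
            (Even #(G.filter (· < m (3 * i + 1))) ↔ σ i) := by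
      intro p q hp hpq hq hor hσ
      have hmpq : m p < m q := hm hpq
      have hpF : m p ∉ F := fun h => absurd (hFlt _ h) (not_lt.2 hp)
      have hqF : m q ∉ F := fun h => absurd (hFlt _ h) (not_lt.2 (hp.trans hmpq.le))
      have hqp : m q ∉ insert (m p) F := by simp [hqF, hmpq.ne']
      refine ⟨insert (m q) (insert (m p) F), ?_, ?_, ?_, ?_⟩
      · intro i hi
        simp only [Finset.coe_insert, mem_insert_iff] at hi
        rcases hi with rfl | rfl | hi
        · exact ⟨_, rfl⟩
        · exact ⟨_, rfl⟩
        · exact hFm hi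
      · intro i hi
        simp only [Finset.mem_insert] at hi
        rcases hi with rfl | rfl | hi
        · exact hm hq
        · exact hm (hpq.trans hq)
        · exact (hFlt i hi).trans (hm (by omega))
      · rw [Finset.card_insert_of_notMem hqp, Finset.card_insert_of_notMem hpF, hFc]
        ring
      · intro i hi
        rcases Nat.lt_succ_iff_lt_or_eq.1 hi with hi | rfl
        · have hlt : m (3 * i + 1) < m (3 * n) := hm (by omega)
          refine ⟨by simp [(hF i hi).1], ?_⟩
          rw [Finset.filter_insert, if_neg (by omega), Finset.filter_insert, if_neg (by omega)]
          exact (hF i hi).2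
        · have hall : ∀ k ∈ F, k < m (3 * i + 1) := fun k hk => (hFlt k hk).trans (hm (by omega))
          by_cases hpe : p = 3 * i + 1
          · subst hpe
            refine ⟨by simp, ?_⟩
            rw [Finset.filter_insert, if_neg (by omega), Finset.filter_insert, if_neg (by omega),
              Finset.filter_true_of_mem hall, hFc]
            simpa using hσ
          · obtain rfl := hor.resolve_left hpe
            refine ⟨by simp, ?_⟩
            rw [Finset.filter_insert, if_neg (by omega), Finset.filter_insert, if_pos hmpq,
              Finset.filter_true_of_mem hall, Finset.card_insert_of_notMem hpF, hFc, ← hσ]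
            simp [hpe]
    by_cases hσ : σ n
    · exact ext (3 * n + 1) (3 * n + 2) (hm.monotone (by omega)) (by omega) (by omega) (.inl rfl)
        (by simpa using hσ)
    · exact ext (3 * n) (3 * n + 1) le_rfl (by omega) (by omega) (.inr rfl) (by simpa using hσ)

/-- The values of `f` on `x i`, `i ∈ F`, are alternately at most `r` and at least `r'`. -/
def Alternates (x : ℕ → X) (r r' : ℝ) (f : X →L[ℝ] ℝ) (F : Finset ℕ) : Prop :=
  ∀ i ∈ F, (Even #(F.filter (· < i)) → f (x i) ≤ r) ∧ (¬ Even #(F.filter (· < i)) → r' ≤ f (x i))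

theorem HasAntipodal.of_alternates {x : ℕ → X} {R : ℝ} (hR : ∀ n, ‖x n‖ ≤ R) {r r' : ℝ}
    (hr : r < r') {M : Set ℕ} (hM : M.Infinite)
    (h : ∀ F : Finset ℕ, (F : Set ℕ) ⊆ M → ∃ f : X →L[ℝ] ℝ, ‖f‖ ≤ 1 ∧ Alternates x r r' f F) :
    HasAntipodal X := by
  obtain ⟨m, hm, hmM⟩ := exists_strictMono_mem hM
  refine HasAntipodal.of_l1 (w := fun i => x (m (3 * i + 1))) (fun n => hR _)
    (half_pos (sub_pos.2 hr)) fun a F => ?_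
  have hsign : ∀ (σ : ℕ → Prop) (n : ℕ), ∃ f : X →L[ℝ] ℝ, ‖f‖ ≤ 1 ∧ ∀ i < n,
      (σ i → f (x (m (3 * i + 1))) ≤ r) ∧ (¬ σ i → r' ≤ f (x (m (3 * i + 1)))) := by
    intro σ n
    obtain ⟨G, hG, -, -, hp⟩ := exists_finset_rank_parity hm σ n
    obtain ⟨f, hf, hal⟩ := h G (hG.trans (by rintro _ ⟨i, rfl⟩; exact hmM i))
    refine ⟨f, hf, fun i hi => ?_⟩
    rw [← (hp i hi).2]
    exact hal _ (hp i hi).1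
  obtain ⟨f, hf, hfs⟩ := hsign (fun i => 0 ≤ a i) (a.support.sup (· + 1))
  obtain ⟨g, hg, hgs⟩ := hsign (fun i => ¬ 0 ≤ a i) (a.support.sup (· + 1))
  set T := Finsupp.linearCombination ℝ (fun i => x (m (3 * i + 1))) a with hT
  have h1 : (r' - r) * ∑ i ∈ a.support, |a i| ≤ g T - f T := by
    have hval : ∀ k : X →L[ℝ] ℝ, k T = ∑ i ∈ a.support, a i * k (x (m (3 * i + 1))) := by
      intro k
      simp [hT, Finsupp.linearCombination_apply, Finsupp.sum, map_sum]
    rw [hval, hval, ← Finset.sum_sub_distrib, Finset.mul_sum]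
    refine Finset.sum_le_sum fun i hi => ?_
    have hin : i < a.support.sup (· + 1) := Nat.lt_of_succ_le (Finset.le_sup (f := (· + 1)) hi)
    by_cases hai : 0 ≤ a i
    · have h1 := (hfs i hin).1 hai
      have h2 := (hgs i hin).2 (not_not.2 hai)
      rw [abs_of_nonneg hai]
      nlinarith
    · have h1 := (hfs i hin).2 hai
      have h2 := (hgs i hin).1 hai
      rw [abs_of_neg (not_le.1 hai)]
      nlinarith [not_le.1 hai]
  have h2 : ∑ i ∈ F, |a i| ≤ ∑ i ∈ a.support, |a i| := by
    rw [← Finset.sum_filter_of_ne (s := F) (p := (· ∈ a.support))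
      fun i _ hi => by simpa using hi]
    exact Finset.sum_le_sum_of_subset_of_nonneg (fun i hi => (Finset.mem_filter.1 hi).2)
      fun i _ _ => abs_nonneg _
  have h3 := (abs_le.1 (abs_apply_le hf T)).1
  have h4 := (abs_le.1 (abs_apply_le hg T)).2
  nlinarith

theorem not_infinite_of_initSeg_not_alternates {x : ℕ → X} {r r' : ℝ} {M : Set ℕ}
    (h : ∀ N ⊆ M, N.Infinite → ∃ k, ¬ ∃ f : X →L[ℝ] ℝ, ‖f‖ ≤ 1 ∧ Alternates x r r' f (initSeg N k))
    (f : X →L[ℝ] ℝ) (hf : ‖f‖ ≤ 1) :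
    ¬ ({i ∈ M | f (x i) ≤ r}.Infinite ∧ {i ∈ M | r' ≤ f (x i)}.Infinite) := by
  rintro ⟨h1, h2⟩
  obtain ⟨φ, hφ, hP⟩ := extraction_forall_of_frequently (P := fun n k => k ∈ M ∧
    (Even n → f (x k) ≤ r) ∧ (¬ Even n → r' ≤ f (x k))) (by
      intro n
      by_cases hn : Even n
      · exact (Nat.frequently_atTop_iff_infinite.2 h1).mono fun k hk =>
          ⟨hk.1, fun _ => hk.2, fun h => absurd hn h⟩
      · exact (Nat.frequently_atTop_iff_infinite.2 h2).mono fun k hk =>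
          ⟨hk.1, fun h => absurd h hn, fun _ => hk.2⟩)
  obtain ⟨k, hk⟩ := h (Set.range φ) (by rintro _ ⟨i, rfl⟩; exact (hP i).1)
    (infinite_range_of_injective hφ.injective)
  refine hk ⟨f, hf, fun i hi => ?_⟩
  obtain ⟨hik, n, rfl⟩ := mem_initSeg.1 hi
  have hcard : #((initSeg (Set.range φ) k).filter (· < φ n)) = n := by
    have : (initSeg (Set.range φ) k).filter (· < φ n) = (Finset.range n).image φ := by
      ext j
      simp only [Finset.mem_filter, mem_initSeg, Set.mem_range, Finset.mem_image, Finset.mem_range]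
      constructor
      · rintro ⟨⟨-, p, rfl⟩, hlt⟩
        exact ⟨p, hφ.lt_iff_lt.1 hlt, rfl⟩
      · rintro ⟨p, hp, rfl⟩
        exact ⟨⟨(hφ hp).trans hik, p, rfl⟩, hφ hp⟩
    rw [this, Finset.card_image_of_injective _ hφ.injective, Finset.card_range]
  rw [hcard]
  exact (hP n).2

/-- A form of Rosenthal's `ℓ₁` theorem. -/
theorem exists_weaklyCauchy_subseq (hX : ¬ HasAntipodal X) {x : ℕ → X} {R : ℝ}
    (hR : ∀ n, ‖x n‖ ≤ R) :
    ∃ φ : ℕ → ℕ, StrictMono φ ∧ ∀ f : X →L[ℝ] ℝ, ∃ c, Tendsto (fun n => f (x (φ n))) atTop (𝓝 c) := by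
  obtain ⟨M, -, hM, hPM⟩ := exists_diagonal (fun s A => ∀ q : ℚ × ℚ, Encodable.encode q = #s →
    q.1 < q.2 → ∀ f : X →L[ℝ] ℝ, ‖f‖ ≤ 1 →
      ¬ ({i ∈ A | f (x i) ≤ (q.1 : ℝ)}.Infinite ∧ {i ∈ A | (q.2 : ℝ) ≤ f (x i)}.Infinite))
    (by
      intro s A B h hBA q hq hlt f hf hinf
      exact h q hq hlt f hf ⟨hinf.1.mono fun i hi => ⟨hBA hi.1, hi.2⟩,
        hinf.2.mono fun i hi => ⟨hBA hi.1, hi.2⟩⟩)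
    (by
      intro s A hA
      by_cases hq : ∃ q : ℚ × ℚ, Encodable.encode q = #s ∧ q.1 < q.2
      · obtain ⟨q, hq, hlt⟩ := hq
        obtain ⟨B, hBA, hB, h⟩ := exists_galvin
          {F | ¬ ∃ f : X →L[ℝ] ℝ, ‖f‖ ≤ 1 ∧ Alternates x q.1 q.2 f F} hA
        refine ⟨B, hBA, hB, fun q' hq' _ => ?_⟩
        obtain rfl : q' = q := Encodable.encode_injective (hq'.trans hq.symm)
        rcases h with h | h
        · refine absurd (HasAntipodal.of_alternates hR (Rat.cast_lt.2 hlt) hB fun F hF => ?_) hX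
          simpa only [Set.mem_ofPred_eq, not_not] using h F hF
        · exact not_infinite_of_initSeg_not_alternates h
      · exact ⟨A, Subset.rfl, hA, fun q hq' hlt => absurd ⟨q, hq', hlt⟩ hq⟩) infinite_univ
  obtain ⟨φ, hφ, hφM⟩ := exists_strictMono_mem hM
  have key : ∀ g : X →L[ℝ] ℝ, ‖g‖ ≤ 1 → ∃ c, Tendsto (fun n => g (x (φ n))) atTop (𝓝 c) := by
    intro g hg
    have hb : ∀ n, |g (x (φ n))| ≤ R := fun n => (abs_apply_le hg _).trans (hR _)
    refine tendsto_of_no_upcrossings (s := Set.range ((↑) : ℚ → ℝ)) Rat.denseRange_cast ?_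
      (isBoundedUnder_of ⟨R, fun n => (abs_le.1 (hb n)).2⟩)
      (isBoundedUnder_of ⟨-R, fun n => (abs_le.1 (hb n)).1⟩)
    rintro _ ⟨p, rfl⟩ _ ⟨q, rfl⟩ hpq ⟨h1, h2⟩
    obtain ⟨s, hs, hsc⟩ := hM.exists_subset_card_eq (Encodable.encode (p, q))
    have hinf : ∀ Q : ℕ → Prop, (∃ᶠ n in atTop, Q (φ n)) → {i ∈ after M s | Q i}.Infinite := by
      intro Q hQ
      have : {i ∈ M | Q i}.Infinite :=
        ((Nat.frequently_atTop_iff_infinite.1 hQ).image hφ.injective.injOn).mono (by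
          rintro _ ⟨n, hn, rfl⟩
          exact ⟨hφM n, hn⟩)
      exact (infinite_after this s).mono fun i hi => ⟨⟨hi.1.1, hi.2⟩, hi.1.2⟩
    exact hPM s hs (p, q) hsc.symm (Rat.cast_lt.1 hpq) g hg
      ⟨hinf (fun i => g (x i) ≤ p) (h1.mono fun n hn => hn.le),
        hinf (fun i => (q : ℝ) ≤ g (x i)) (h2.mono fun n hn => hn.le)⟩
  refine ⟨φ, hφ, fun f => ?_⟩
  have hpos : 0 < ‖f‖ + 1 := by positivity
  obtain ⟨c, hc⟩ := key ((‖f‖ + 1)⁻¹ • f) (by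
    rw [norm_smul, Real.norm_of_nonneg (inv_pos.2 hpos).le, inv_mul_le_one₀ hpos]
    linarith)
  refine ⟨(‖f‖ + 1) * c, (hc.const_mul (‖f‖ + 1)).congr fun n => ?_⟩
  simp [hpos.ne']

/-- The sum of the vectors `x i`, `i ∈ F`, with alternating signs. -/
def altSum (x : ℕ → X) (F : Finset ℕ) : X := ∑ i ∈ F, (-1 : ℝ) ^ #(F.filter (· < i)) • x i

theorem altSum_union (x : ℕ → X) {F G : Finset ℕ} (h : ∀ i ∈ F, ∀ j ∈ G, i < j) :
    altSum x (F ∪ G) = altSum x F + (-1 : ℝ) ^ #F • altSum x G := by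
  have hd : Disjoint F G := Finset.disjoint_left.2 fun i hi hi' => lt_irrefl _ (h i hi i hi')
  rw [altSum, Finset.sum_union hd, altSum, altSum, Finset.smul_sum]
  congr 1
  · refine Finset.sum_congr rfl fun i hi => ?_
    rw [Finset.filter_union, Finset.filter_false_of_mem (s := G) fun j hj => (h i hi j hj).not_gt,
      Finset.union_empty]
  · refine Finset.sum_congr rfl fun j hj => ?_
    rw [Finset.filter_union, Finset.filter_true_of_mem (s := F) fun i hi => h i hi j hj,
      Finset.card_union_of_disjoint (hd.mono_right (Finset.filter_subset _ _)), pow_add, smul_smul]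

theorem abs_apply_altSum_le (x : ℕ → X) (f : X →L[ℝ] ℝ) (F : Finset ℕ) :
    |f (altSum x F)| ≤ ∑ i ∈ F, |f (x i)| := by
  rw [altSum, map_sum]
  refine (Finset.abs_sum_le_sum_abs _ _).trans_eq (Finset.sum_congr rfl fun i _ => ?_)
  rw [map_smul, smul_eq_mul, abs_mul, abs_pow, abs_neg, abs_one, one_pow, one_mul]

theorem exists_union_initSeg_eq {F : Finset ℕ} {N : Set ℕ} (h : ∀ i ∈ F, ∀ n ∈ N, i < n) (k : ℕ) :
    ∃ l, F ∪ initSeg N k = initSeg (F ∪ N) l := by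
  refine ⟨max k (F.sup (· + 1)), ?_⟩
  ext i
  have hF : i ∈ F → i < F.sup (· + 1) := fun hi =>
    Nat.lt_of_succ_le (Finset.le_sup (f := (· + 1)) hi)
  have hN : i ∈ N → F.sup (· + 1) ≤ i := fun hi => Finset.sup_le fun j hj => h j hj i hi
  simp only [Finset.mem_union, mem_initSeg, Set.mem_union, Finset.mem_coe]
  grind

/-- Elton's perturbation argument: given a thin family `𝓕` of finite sets and a weakly null
sequence `x`, after passing to an infinite set the norming functionals of the vectors `y F` can be
taken to be almost zero on the terms of `x` with indices off `F`. -/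
theorem exists_functional_small_off {x : ℕ → X}
    (hx : ∀ f : X →L[ℝ] ℝ, Tendsto (fun n => f (x n)) atTop (𝓝 0)) {𝓕 : Set (Finset ℕ)}
    (hthin : ∀ N k l, initSeg N k ∈ 𝓕 → initSeg N l ∈ 𝓕 → initSeg N k = initSeg N l)
    {y : Finset ℕ → X} {t δ : ℝ} (hδ : 0 < δ)
    (hy : ∀ F ∈ 𝓕, ∃ f : X →L[ℝ] ℝ, ‖f‖ ≤ 1 ∧ t ≤ f (y F)) {L : Set ℕ} (hL : L.Infinite) :
    ∃ M ⊆ L, M.Infinite ∧ ∀ F : Finset ℕ, (F : Set ℕ) ⊆ M → F ∈ 𝓕 →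
      ∃ f : X →L[ℝ] ℝ, ‖f‖ ≤ 1 ∧ t ≤ f (y F) ∧
        ∀ H : Finset ℕ, (H : Set ℕ) ⊆ M → Disjoint F H → ∑ i ∈ H, |f (x i)| ≤ δ := by
  obtain ⟨M, hML, hM, hI⟩ := exists_fusion (fun s A => (∀ a ∈ A, ∀ i ∈ s, i < a) ∧
    ∀ F ⊆ s, ∀ G : Finset ℕ, (G : Set ℕ) ⊆ A → F ∪ G ∈ 𝓕 → ∃ f : X →L[ℝ] ℝ, ‖f‖ ≤ 1 ∧
      t ≤ f (y (F ∪ G)) ∧ ∑ i ∈ s \ F, |f (x i)| ≤ δ * (1 - (1 / 2) ^ #s)) hL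
    (by
      refine ⟨by simp, fun F hF G _ hG => ?_⟩
      obtain ⟨f, hf, hfy⟩ := hy _ hG
      exact ⟨f, hf, hfy, by simp⟩)
    (by
      rintro s A hA - ⟨hsA, hI⟩
      set η := δ * (1 / 2) ^ (#s + 1) with hη
      have hη0 : 0 < η := by positivity
      let bad : ℕ × Finset ℕ → Set (Finset ℕ) := fun p => {G | p.2 ∪ G ∈ 𝓕 ∧
        ∀ f : X →L[ℝ] ℝ, ‖f‖ ≤ 1 → t ≤ f (y (p.2 ∪ G)) →
          ∑ i ∈ s \ p.2, |f (x i)| ≤ δ * (1 - (1 / 2) ^ #s) → η < |f (x p.1)|}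
      let D : ℕ × Finset ℕ → Set ℕ → Prop := fun p B =>
        (∀ G : Finset ℕ, (G : Set ℕ) ⊆ B → G ∉ bad p) ∨
          ∀ N ⊆ B, N.Infinite → ∃ k, initSeg N k ∈ bad p
      have hDher : ∀ p A B, D p A → B ⊆ A → D p B := by
        rintro p A B (h | h) hBA
        · exact .inl fun G hG => h G (hG.trans hBA)
        · exact .inr fun N hN => h N (hN.trans hBA)
      obtain ⟨M, hMA, hM, hD⟩ := exists_diagonal (fun r B => ∀ p ∈ r ×ˢ s.powerset, D p B)
        (fun r A B h hBA p hp => hDher p A B (h p hp) hBA)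
        (fun r A hA => exists_forall_mem_finset D hDher (fun p A hA => exists_galvin _ hA) _ hA) hA
      have hD' : ∀ z ∈ M, ∀ F ⊆ s, D (z, F) (after M {z}) := fun z hz F hF =>
        hD {z} (by simpa using hz) (z, F) (by simpa using hF)
      by_cases hgood : ∃ z ∈ M, ∀ F ⊆ s, ∀ G : Finset ℕ, (G : Set ℕ) ⊆ after M {z} → G ∉ bad (z, F)
      · obtain ⟨z, hz, hgood⟩ := hgood
        have hzs : z ∉ s := fun h => lt_irrefl _ (hsA z (hMA hz) z h)
        refine ⟨z, hMA hz, after M {z}, (after_subset _ _).trans hMA, infinite_after hM _,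
          fun a ha => ha.2 z (by simp), ?_, fun F hF G hG hFG => ?_⟩
        · intro a ha i hi
          rcases Finset.mem_insert.1 hi with rfl | hi
          · exact ha.2 i (by simp)
          · exact hsA a (hMA ha.1) i hi
        · rw [Finset.card_insert_of_notMem hzs]
          by_cases hzF : z ∈ F
          · have hFe : F.erase z ⊆ s := by grind
            have hun : F.erase z ∪ insert z G = F ∪ G := by grind
            have hsd : insert z s \ F = s \ F.erase z := by
              ext i
              by_cases h : i = z
              · subst h
                simp [hzF, hzs]
              · simp [h]
            obtain ⟨f, hf, hfy, hfs⟩ := hI (F.erase z) hFe (insert z G) (by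
              rw [Finset.coe_insert]
              exact insert_subset (hMA hz) (hG.trans ((after_subset _ _).trans hMA)))
              (by rwa [hun])
            rw [hun] at hfy
            refine ⟨f, hf, hfy, ?_⟩
            rw [hsd]
            refine hfs.trans ?_
            rw [pow_succ]
            linarith [show 0 ≤ δ * (1 / 2) ^ #s by positivity]
          · have hFs : F ⊆ s := (Finset.subset_insert_iff_of_notMem hzF).1 hF
            have := hgood F hFs G hG
            simp only [bad, Set.mem_ofPred_eq, not_and, not_forall, not_lt] at this
            obtain ⟨f, hf, hfy, hfs, hfz⟩ := this hFG
            refine ⟨f, hf, hfy, ?_⟩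
            rw [Finset.insert_sdiff_of_notMem _ hzF, Finset.sum_insert (by simp [hzs])]
            rw [hη] at hfz
            rw [pow_succ] at hfz ⊢
            linarith
      · push Not at hgood
        exfalso
        let Z : Finset ℕ → Set ℕ := fun F => {z ∈ M | ∀ N ⊆ after M {z}, N.Infinite →
          ∃ k, initSeg N k ∈ bad (z, F)}
        have hZ : ∃ F ⊆ s, (Z F).Infinite := by
          by_contra! hfin
          refine hM (((Finset.finite_toSet s.powerset).biUnion (t := Z) fun F hF =>
            hfin F (Finset.mem_powerset.1 hF)).subset fun z hz => ?_)
          obtain ⟨F, hF, G, hG, hGb⟩ := hgood z hz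
          simp only [mem_iUnion]
          exact ⟨F, Finset.mem_coe.2 (Finset.mem_powerset.2 hF), hz,
            (hD' z hz F hF).resolve_left fun h => h G hG hGb⟩
        obtain ⟨F, hF, hZ⟩ := hZ
        have hex : ∀ K, ∃ f : X →L[ℝ] ℝ, ‖f‖ ≤ 1 ∧ ∀ z ∈ Z F, z < K → η ≤ |f (x z)| := by
          intro K
          set N := after M (initSeg (Z F) K)
          have hN : N.Infinite := infinite_after hM _
          have hFN : ∀ i ∈ F, ∀ n ∈ N, i < n := fun i hi n hn => hsA n (hMA hn.1) i (hF hi)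
          have hseg : ∀ z ∈ Z F, z < K → ∃ k, initSeg N k ∈ bad (z, F) := fun z hz hzK =>
            hz.2 N (fun n hn => ⟨hn.1, by simpa using hn.2 z (mem_initSeg.2 ⟨hzK, hz⟩)⟩) hN
          by_cases hne : ∃ z ∈ Z F, z < K
          · obtain ⟨z₀, hz₀, hz₀K⟩ := hne
            obtain ⟨k₀, hk₀⟩ := hseg z₀ hz₀ hz₀K
            obtain ⟨f, hf, hfy, hfs⟩ := hI F hF (initSeg N k₀)
              ((initSeg_subset _ _).trans ((after_subset _ _).trans hMA)) hk₀.1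
            refine ⟨f, hf, fun z hz hzK => ?_⟩
            obtain ⟨k, hk⟩ := hseg z hz hzK
            obtain ⟨l₀, hl₀⟩ := exists_union_initSeg_eq hFN k₀
            obtain ⟨l, hl⟩ := exists_union_initSeg_eq hFN k
            have heq : F ∪ initSeg N k = F ∪ initSeg N k₀ := by
              rw [hl₀, hl]
              exact hthin _ _ _ (hl ▸ hk.1) (hl₀ ▸ hk₀.1)
            exact (hk.2 f hf (by rw [heq]; exact hfy) hfs).le
          · push Not at hne
            exact ⟨0, by simp, fun z hz hzK => absurd (hne z hz) (not_le.2 hzK)⟩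
        choose f hf hfz using hex
        obtain ⟨g, -, hg⟩ := exists_dual_limit (hyperfilter ℕ) f hf
        have hgz : ∀ z ∈ Z F, η ≤ |g (x z)| := fun z hz => ge_of_tendsto (hg (x z)).abs
          (((eventually_gt_atTop z).filter_mono Nat.hyperfilter_le_atTop).mono fun K hK =>
            hfz K z hz hK)
        obtain ⟨z, hz, hlt⟩ := ((Nat.frequently_atTop_iff_infinite.2 hZ).and_eventually
          ((hx g).abs.eventually_lt_const (by simpa using hη0))).exists
        exact hlt.not_ge (hgz z hz))
  refine ⟨M, hML, hM, fun F hF hF𝓕 => ?_⟩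
  have hex : ∀ k, ∃ f : X →L[ℝ] ℝ, ‖f‖ ≤ 1 ∧ t ≤ f (y F) ∧
      ∑ i ∈ initSeg M k \ F, |f (x i)| ≤ δ := by
    intro k
    obtain ⟨A, -, -, ⟨-, hA⟩, -⟩ := hI (max k (F.sup (· + 1)))
    obtain ⟨f, hf, hfy, hfs⟩ := hA F (fun i hi => mem_initSeg.2 ⟨lt_max_of_lt_right
      (Nat.lt_of_succ_le (Finset.le_sup (f := (· + 1)) hi)), hF hi⟩) ∅ (by simp) (by simpa)
    refine ⟨f, hf, by simpa using hfy, (Finset.sum_le_sum_of_subset_of_nonneg ?_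
      fun _ _ _ => abs_nonneg _).trans (hfs.trans ?_)⟩
    · refine Finset.sdiff_subset_sdiff (fun i hi => ?_) Finset.Subset.rfl
      rw [mem_initSeg] at hi ⊢
      exact ⟨lt_max_of_lt_left hi.1, hi.2⟩
    · exact mul_le_of_le_one_right hδ.le (sub_le_self _ (by positivity))
  choose f hf hfy hfs using hex
  obtain ⟨g, hg1, hg⟩ := exists_dual_limit (hyperfilter ℕ) f hf
  refine ⟨g, hg1, ge_of_tendsto' (hg _) hfy, fun H hH hFH => ?_⟩
  refine le_of_tendsto (tendsto_finsetSum H fun i _ => (hg (x i)).abs)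
    (((eventually_ge_atTop (H.sup (· + 1))).filter_mono Nat.hyperfilter_le_atTop).mono
      fun k hk => (Finset.sum_le_sum_of_subset_of_nonneg (fun i hi => ?_)
        fun _ _ _ => abs_nonneg _).trans (hfs k))
  rw [Finset.mem_sdiff, mem_initSeg]
  exact ⟨⟨(Nat.lt_of_succ_le (Finset.le_sup (f := (· + 1)) hi)).trans_le hk, hH hi⟩,
    Finset.disjoint_right.1 hFH hi⟩

/-- The finite sets at which the norm of the alternating sum first exceeds `t`. -/
def crossings (x : ℕ → X) (t : ℝ) : Set (Finset ℕ) :=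
  {F | t < ‖altSum x F‖ ∧ ∀ k, t < ‖altSum x (initSeg F k)‖ → initSeg F k = F}

theorem initSeg_eq_of_mem_crossings {x : ℕ → X} {t : ℝ} (N : Set ℕ) (k l : ℕ)
    (hk : initSeg N k ∈ crossings x t) (hl : initSeg N l ∈ crossings x t) :
    initSeg N k = initSeg N l := by
  wlog hkl : k ≤ l generalizing k l
  · exact (this l k hl hk (le_of_not_ge hkl)).symm
  · have h : initSeg (initSeg N l) k = initSeg N k := by rw [initSeg_initSeg, min_eq_right hkl]
    rw [← h]
    exact hl.2 k (by rw [h]; exact hk.1)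

theorem exists_initSeg_mem_crossings {x : ℕ → X} {t : ℝ} {N : Set ℕ}
    (h : ∃ k, t < ‖altSum x (initSeg N k)‖) : ∃ k, initSeg N k ∈ crossings x t := by
  classical
  refine ⟨Nat.find h, Nat.find_spec h, fun l hl => ?_⟩
  rw [initSeg_initSeg] at hl ⊢
  rw [min_eq_left ((Nat.find_min' h hl).trans (min_le_right _ _))]

/-- `F` has odd cardinality at least three and its alternating sum has partial sums of norm at
most `c`. -/
def IsGoodBlock (x : ℕ → X) (c : ℝ) (F : Finset ℕ) : Prop :=
  Odd #F ∧ 3 ≤ #F ∧ ∀ k, ‖altSum x (initSeg F k)‖ ≤ c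

theorem initSeg_coe_of_le {F : Finset ℕ} {k : ℕ} (h : ∀ i ∈ F, i < k) : initSeg F k = F := by
  ext i
  simp only [mem_initSeg, Finset.mem_coe]
  exact ⟨fun hi => hi.2, fun hi => ⟨h i hi, hi⟩⟩

theorem IsGoodBlock.norm_altSum_le {x : ℕ → X} {c : ℝ} {F : Finset ℕ} (h : IsGoodBlock x c F) :
    ‖altSum x F‖ ≤ c := by
  have := h.2.2 (F.sup (· + 1))
  rwa [initSeg_coe_of_le fun i hi => Nat.lt_of_succ_le (Finset.le_sup (f := (· + 1)) hi)] at this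

theorem HasAntipodal.of_crossing_blocks {x : ℕ → X} {c t δ : ℝ} (hδ : 0 < δ) (ht : c + 2 * δ ≤ t)
    {M : Set ℕ}
    (hM : ∀ F : Finset ℕ, (F : Set ℕ) ⊆ M → F ∈ crossings x t →
      ∃ f : X →L[ℝ] ℝ, ‖f‖ ≤ 1 ∧ t ≤ f (altSum x F) ∧
        ∀ H : Finset ℕ, (H : Set ℕ) ⊆ M → Disjoint F H → ∑ i ∈ H, |f (x i)| ≤ δ)
    {F : ℕ → Finset ℕ} (hFM : ∀ n, (F n : Set ℕ) ⊆ M) (hF : ∀ n, IsGoodBlock x c (F n))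
    (hlt : ∀ n m, n < m → ∀ i ∈ F n, ∀ j ∈ F m, i < j)
    (hcross : ∀ n m, n < m → ∃ k, t < ‖altSum x (initSeg (F n ∪ F m : Finset ℕ) k)‖) :
    HasAntipodal X := by
  have hdisj : ∀ n m, n ≠ m → Disjoint (F n) (F m) := by
    intro n m hnm
    refine Finset.disjoint_left.2 fun i hi hi' => ?_
    rcases hnm.lt_or_gt with h | h
    · exact lt_irrefl _ (hlt _ _ h i hi i hi')
    · exact lt_irrefl _ (hlt _ _ h i hi' i hi)
  refine HasAntipodal.of_seq (u := fun n => altSum x (F n)) (D := c + δ) (by linarith)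
    (fun n => (hF n).norm_altSum_le) fun n m hnm => ?_
  obtain ⟨k, hk⟩ := exists_initSeg_mem_crossings (hcross n m hnm)
  set G := initSeg (F n ∪ F m : Finset ℕ) k with hG
  set H := (F n ∪ F m) \ G with hH
  have hsub : ((F n ∪ F m : Finset ℕ) : Set ℕ) ⊆ M := by
    rw [Finset.coe_union]
    exact union_subset (hFM n) (hFM m)
  obtain ⟨f, hf, hft, hfs⟩ := hM G ((initSeg_subset _ _).trans hsub) hk
  have hun : G ∪ H = F n ∪ F m := Finset.union_sdiff_of_subset fun i hi => initSeg_subset _ _ hi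
  have h1 : f (altSum x (F n)) - f (altSum x (F m)) =
      f (altSum x G) + (-1) ^ #G * f (altSum x H) := by
    have e1 := altSum_union x (hlt n m hnm)
    have e2 := altSum_union x (F := G) (G := H) (by
      intro i hi j hj
      rw [hH, Finset.mem_sdiff] at hj
      have := mem_initSeg.1 hi
      have : ¬ j < k := fun h => hj.2 (mem_initSeg.2 ⟨h, hj.1⟩)
      omega)
    rw [hun, e1, (hF n).1.neg_one_pow] at e2
    simpa [sub_eq_add_neg] using congrArg f e2
  have h2 : |f (altSum x H)| ≤ δ := (abs_apply_altSum_le x f H).trans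
    (hfs H (fun i hi => hsub (Finset.mem_sdiff.1 hi).1) Finset.disjoint_sdiff)
  have h3 : |(-1) ^ #G * f (altSum x H)| ≤ δ := by
    rwa [abs_mul, abs_pow, abs_neg, abs_one, one_pow, one_mul]
  have h4 : f (altSum x (F n)) ≤ c :=
    ((le_abs_self _).trans (abs_apply_le hf _)).trans (hF n).norm_altSum_le
  have h5 : -c ≤ f (altSum x (F m)) :=
    (neg_le_neg (hF m).norm_altSum_le).trans (abs_le.1 (abs_apply_le hf _)).1
  have h6 : c + δ ≤ f (altSum x (F n)) - f (altSum x (F m)) := by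
    linarith [(abs_le.1 h3).1]
  refine ⟨f, hf, h6, fun z => ?_⟩
  rcases eq_or_ne z n with rfl | hzn
  · constructor <;> linarith
  rcases eq_or_ne z m with rfl | hzm
  · constructor <;> linarith
  have hz : |f (altSum x (F z))| ≤ δ := (abs_apply_altSum_le x f _).trans (hfs _ (hFM z)
    ((Finset.disjoint_union_left.2 ⟨hdisj _ _ hzn.symm, hdisj _ _ hzm.symm⟩).mono_left
      fun i hi => initSeg_subset _ _ hi))
  have := abs_le.1 hz
  constructor <;> linarith

theorem exists_prepend_block (hX : ¬ HasAntipodal X) {x : ℕ → X}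
    (hx : ∀ f : X →L[ℝ] ℝ, Tendsto (fun n => f (x n)) atTop (𝓝 0)) {c t : ℝ} (hct : c < t)
    {L : Set ℕ} (hL : L.Infinite) (K₀ : ℕ) :
    ∃ M ⊆ L, M.Infinite ∧ ∃ K ≥ K₀, ∀ V : Finset ℕ, (V : Set ℕ) ⊆ M → IsGoodBlock x c V →
      ∃ V' : Finset ℕ, (V' : Set ℕ) ⊆ L ∧ IsGoodBlock x t V' ∧
        ∀ k ≥ K, #(initSeg V k) + 2 ≤ #(initSeg V' k) := by
  obtain ⟨M, hML, hM, hfun⟩ := exists_functional_small_off (y := altSum x) (t := t)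
    (δ := (t - c) / 2) hx
    (initSeg_eq_of_mem_crossings (x := x) (t := t)) (by linarith)
    (fun F hF => by
      obtain ⟨f, hf, hfF⟩ := exists_dual_vector'' ℝ (altSum x F)
      exact ⟨f, hf, by simpa [hfF] using hF.1.le⟩) hL
  have hT : ∃ T : Finset (Finset ℕ), (∀ U ∈ T, (U : Set ℕ) ⊆ M ∧ IsGoodBlock x c U) ∧
      ∀ V : Finset ℕ, (V : Set ℕ) ⊆ M ∧ IsGoodBlock x c V → ∃ U ∈ T,
        ¬ ((∀ i ∈ U, ∀ j ∈ V, i < j) ∧ ∃ k, t < ‖altSum x (initSeg (U ∪ V : Finset ℕ) k)‖) := by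
    by_contra! hcon
    obtain ⟨F, hF, hFF⟩ := exists_seq_of_forall_finset_exists
      (fun V : Finset ℕ => (V : Set ℕ) ⊆ M ∧ IsGoodBlock x c V)
      (fun U V => (∀ i ∈ U, ∀ j ∈ V, i < j) ∧
        ∃ k, t < ‖altSum x (initSeg (U ∪ V : Finset ℕ) k)‖) hcon
    exact hX (HasAntipodal.of_crossing_blocks (by linarith) (by linarith) hfun
      (fun n => (hF n).1) (fun n => (hF n).2) (fun n m h => (hFF n m h).1)
      fun n m h => (hFF n m h).2)
  obtain ⟨T, hTM, hT⟩ := hT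
  set K := max K₀ ((T.sup id).sup (· + 1)) with hK
  refine ⟨{m ∈ M | K ≤ m}, (sep_subset _ _).trans hML, ?_, K, le_max_left _ _, fun V hVM hV => ?_⟩
  · exact (hM.sdiff (finite_Iio K)).mono fun m hm => ⟨hm.1, not_lt.1 hm.2⟩
  obtain ⟨U, hU, hUV⟩ := hT V ⟨hVM.trans (sep_subset _ _), hV⟩
  have hUK : ∀ i ∈ U, i < K := fun i hi => lt_max_of_lt_right (Nat.lt_of_succ_le
    (Finset.le_sup (f := (· + 1)) (Finset.le_sup (f := id) hU hi)))
  have hlt : ∀ i ∈ U, ∀ j ∈ V, i < j := fun i hi j hj => (hUK i hi).trans_le (hVM hj).2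
  have hbd : ∀ k, ‖altSum x (initSeg (U ∪ V : Finset ℕ) k)‖ ≤ t := by
    by_contra! h
    exact hUV ⟨hlt, h⟩
  have hVne : V.Nonempty := Finset.card_pos.1 (by have := hV.2.1; omega)
  have hmax := V.max'_mem hVne
  set m := V.max' hVne with hm
  have hKm : K ≤ m := (hVM hmax).2
  have hcard : ∀ l, K ≤ l → #(initSeg (U ∪ V : Finset ℕ) l) = #U + #(initSeg V l) := by
    intro l hl
    rw [← Finset.card_union_of_disjoint (Finset.disjoint_left.2 fun i hi hi' =>
      lt_irrefl _ (hlt i hi i (initSeg_subset _ _ hi')))]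
    congr 1
    ext i
    have := hUK i
    simp only [mem_initSeg, Finset.mem_union, Finset.mem_coe]
    grind
  have hVm : #(initSeg V m) + 1 = #V := by
    rw [← Finset.card_erase_add_one hmax]
    congr 2
    ext i
    simp only [mem_initSeg, Finset.mem_coe, Finset.mem_erase]
    exact ⟨fun h => ⟨h.1.ne, h.2⟩, fun h => ⟨lt_of_le_of_ne (V.le_max' i h.2) h.1, h.2⟩⟩
  refine ⟨initSeg (U ∪ V : Finset ℕ) m, ?_, ⟨?_, ?_, fun k => ?_⟩, fun k hk => ?_⟩
  · refine (initSeg_subset _ _).trans ?_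
    rw [Finset.coe_union]
    exact union_subset ((hTM U hU).1.trans hML) (hVM.trans ((sep_subset _ _).trans hML))
  · have h1 := (hTM U hU).2.1
    have h2 := hV.1
    rw [hcard m hKm]
    rw [Nat.odd_iff] at *
    omega
  · have h1 := (hTM U hU).2.2.1
    rw [hcard m hKm]
    omega
  · rw [initSeg_initSeg]
    exact hbd _
  · have h1 := (hTM U hU).2.2.1
    rw [initSeg_initSeg, hcard _ (le_min hKm hk)]
    have h2 : initSeg V k ⊆ insert m (initSeg V (min m k)) := by
      intro i hi
      rw [mem_initSeg] at hi
      rw [Finset.mem_insert, mem_initSeg]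
      rcases (V.le_max' i hi.2).eq_or_lt with h | h
      · exact .inl h
      · exact .inr ⟨lt_min h hi.1, hi.2⟩
    have h3 := (Finset.card_le_card h2).trans (Finset.card_insert_le _ _)
    omega

theorem exists_altSum_initSeg_le (hX : ¬ HasAntipodal X) {x : ℕ → X}
    (hx : ∀ f : X →L[ℝ] ℝ, Tendsto (fun n => f (x n)) atTop (𝓝 0)) {R c : ℝ}
    (hR : ∀ n, ‖x n‖ ≤ R) (hc : 0 < c) (hRc : 3 * R ≤ c) {L : Set ℕ} (hL : L.Infinite) :
    ∃ N ⊆ L, N.Infinite ∧ ∀ k, ‖altSum x (initSeg N k)‖ ≤ 2 * c := by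
  let t : ℕ → ℝ := fun j => c * (1 + 1 / (j + 1))
  have ht : ∀ j, t (j + 1) < t j := by
    intro j
    refine mul_lt_mul_of_pos_left (add_lt_add_right ?_ 1) hc
    exact one_div_lt_one_div_of_lt (by positivity) (by push_cast; linarith)
  have htc : ∀ j, c ≤ t j := fun j => le_mul_of_one_le_right hc.le
    (le_add_of_nonneg_right (by positivity))
  choose! nxt hnL hnI nK hnK hn using fun (j : ℕ) (L : Set ℕ) (hL : L.Infinite) (K₀ : ℕ) =>
    exists_prepend_block hX hx (ht j) hL K₀
  let q : ℕ → Set ℕ × ℕ := fun j =>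
    Nat.rec (L, 0) (fun j p => (nxt j p.1 p.2, nK j p.1 p.2)) j
  have hq : ∀ j, (q j).1.Infinite := by
    intro j
    induction j with
    | zero => exact hL
    | succ j ih => exact hnI j _ ih _
  have hqK : Monotone fun j => (q j).2 := monotone_nat_of_le_succ fun j => hnK j _ (hq j) _
  have claim : ∀ j, ∀ V : Finset ℕ, (V : Set ℕ) ⊆ (q j).1 → IsGoodBlock x (t j) V →
      ∃ W : Finset ℕ, (W : Set ℕ) ⊆ L ∧ IsGoodBlock x (t 0) W ∧
        (∀ i ≤ j, 2 * i ≤ #(initSeg W (q i).2)) ∧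
        ∀ k ≥ (q j).2, #(initSeg V k) + 2 * j ≤ #(initSeg W k) := by
    intro j
    induction j with
    | zero => exact fun V hV hVt => ⟨V, hV, hVt, fun i hi => by simp [Nat.le_zero.1 hi], by simp⟩
    | succ j ih =>
      intro V hV hVt
      obtain ⟨V', hV', hVt', hk'⟩ := hn j _ (hq j) _ V hV hVt
      obtain ⟨W, hW, hWt, hi, hk⟩ := ih V' hV' hVt'
      have hlast : ∀ k ≥ (q (j + 1)).2, #(initSeg V k) + 2 * (j + 1) ≤ #(initSeg W k) := by
        intro k hkj
        have h1 := hk' k hkj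
        have h2 := hk k ((hqK (Nat.le_succ j)).trans hkj)
        omega
      refine ⟨W, hW, hWt, fun i hij => ?_, hlast⟩
      rcases hij.eq_or_lt with rfl | hij
      · exact (Nat.le_add_left _ _).trans (hlast _ le_rfl)
      · exact hi i (Nat.le_of_lt_succ hij)
  have hex : ∀ j, ∃ W : Finset ℕ, (W : Set ℕ) ⊆ L ∧ IsGoodBlock x (t 0) W ∧
      ∀ i ≤ j, 2 * i ≤ #(initSeg W (q i).2) := by
    intro j
    obtain ⟨V, hV, hV3⟩ := (hq j).exists_subset_card_eq 3
    obtain ⟨W, hW, hWt, hi, -⟩ := claim j V hV ⟨by rw [hV3]; decide, hV3.ge, fun k => by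
      have h1 : ‖altSum x (initSeg V k)‖ ≤ #(initSeg V k) • R := by
        rw [← Finset.sum_const]
        refine norm_sum_le_of_le _ fun i _ => ?_
        rw [norm_smul, norm_pow, norm_neg, norm_one, one_pow, one_mul]
        exact hR i
      have h2 : #(initSeg V k) ≤ 3 := hV3 ▸ Finset.card_le_card fun i hi => initSeg_subset _ _ hi
      have h3 : #(initSeg V k) • R ≤ 3 • R := nsmul_le_nsmul_left ((norm_nonneg _).trans (hR 0)) h2
      have h4 := htc j
      simp only [nsmul_eq_mul] at h1 h3
      push_cast at h3
      linarith⟩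
    exact ⟨W, hW, hWt, hi⟩
  choose W hWL hW hWi using hex
  let N : Set ℕ := {n | ∀ᶠ J in (hyperfilter ℕ : Filter ℕ), n ∈ W J}
  have hN : ∀ k, ∀ᶠ J in (hyperfilter ℕ : Filter ℕ), initSeg N k = initSeg (W J) k := by
    intro k
    have : ∀ᶠ J in (hyperfilter ℕ : Filter ℕ), ∀ n ∈ Finset.range k, (n ∈ N ↔ n ∈ W J) := by
      refine (Filter.eventually_all_finset _).2 fun n _ => ?_
      by_cases hn : n ∈ N
      · exact hn.mono fun J hJ => iff_of_true hn hJ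
      · exact (Ultrafilter.eventually_not.2 hn).mono fun J hJ => iff_of_false hn hJ
    refine this.mono fun J hJ => ?_
    ext n
    simp only [mem_initSeg, Finset.mem_coe]
    exact and_congr_right fun hn => hJ n (Finset.mem_range.2 hn)
  refine ⟨N, fun n hn => ?_, fun hfin => ?_, fun k => ?_⟩
  · obtain ⟨J, hJ⟩ := Eventually.exists hn
    exact hWL J hJ
  · obtain ⟨J, hJ, hJi⟩ := ((hN (q (#hfin.toFinset + 1)).2).and
      ((eventually_ge_atTop (#hfin.toFinset + 1)).filter_mono Nat.hyperfilter_le_atTop)).exists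
    have h1 := hWi J _ hJi
    rw [← hJ] at h1
    have h2 : #(initSeg N (q (#hfin.toFinset + 1)).2) ≤ #hfin.toFinset :=
      Finset.card_le_card fun i hi => hfin.mem_toFinset.2 (initSeg_subset _ _ hi)
    omega
  · obtain ⟨J, hJ⟩ := (hN k).exists
    rw [hJ]
    refine ((hW J).2.2 k).trans_eq ?_
    simp only [t, Nat.cast_zero]
    ring

theorem exists_sum_sub_eq_altSum (y : ℕ → X) {p : ℕ → ℕ × ℕ} (hp : ∀ n, (p n).1 < (p n).2)
    (hlt : ∀ n m, n < m → (p n).2 < (p m).1) {M : Set ℕ} (hM : ∀ n, (p n).1 ∈ M ∧ (p n).2 ∈ M)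
    (I : Finset ℕ) :
    ∃ G : Finset ℕ, (G : Set ℕ) ⊆ M ∧ ∑ i ∈ I, (y (p i).1 - y (p i).2) = altSum y G := by
  have key : ∃ G : Finset ℕ, (G : Set ℕ) ⊆ M ∧ Even #G ∧ (∀ g ∈ G, ∃ i ∈ I, g ≤ (p i).2) ∧
      ∑ i ∈ I, (y (p i).1 - y (p i).2) = altSum y G := by
    induction I using Finset.induction_on_max with
    | empty => exact ⟨∅, by simp, by simp, by simp, by simp [altSum]⟩
    | insert a I ha ih =>
      obtain ⟨G, hGM, hGe, hGp, hG⟩ := ih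
      have hpair : altSum y {(p a).1, (p a).2} = y (p a).1 - y (p a).2 := by
        have := altSum_union y (F := {(p a).1}) (G := {(p a).2}) (by simpa using hp a)
        rw [Finset.insert_eq, this]
        simp [altSum, Finset.filter_singleton, sub_eq_add_neg]
      have hlt' : ∀ g ∈ G, ∀ j ∈ ({(p a).1, (p a).2} : Finset ℕ), g < j := by
        intro g hg j hj
        obtain ⟨i, hi, hgi⟩ := hGp g hg
        have h1 := hlt i a (ha i hi)
        have h2 := hp a
        rcases Finset.mem_insert.1 hj with rfl | hj
        · omega
        · rw [Finset.mem_singleton.1 hj]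
          omega
      refine ⟨G ∪ {(p a).1, (p a).2}, ?_, ?_, ?_, ?_⟩
      · rw [Finset.coe_union]
        refine union_subset hGM ?_
        simpa [insert_subset_iff] using hM a
      · rw [Finset.card_union_of_disjoint (Finset.disjoint_left.2 fun i hi hi' =>
          lt_irrefl _ (hlt' i hi i hi')), Finset.card_pair (hp a).ne]
        exact hGe.add (by decide)
      · intro g hg
        rcases Finset.mem_union.1 hg with hg | hg
        · obtain ⟨i, hi, hgi⟩ := hGp g hg
          exact ⟨i, Finset.mem_insert_of_mem hi, hgi⟩
        · refine ⟨a, Finset.mem_insert_self _ _, ?_⟩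
          have h2 := hp a
          rcases Finset.mem_insert.1 hg with rfl | hg
          · omega
          · rw [Finset.mem_singleton.1 hg]
      · rw [Finset.sum_insert fun h => lt_irrefl _ (ha a h), altSum_union y hlt', hGe.neg_one_pow,
          one_smul, hpair, hG, add_comm]
  obtain ⟨G, hGM, -, -, hG⟩ := key
  exact ⟨G, hGM, hG⟩

theorem HasAntipodal.of_altSum_le {y : ℕ → X}
    (hy : ∀ f : X →L[ℝ] ℝ, Tendsto (fun n => f (y n)) atTop (𝓝 0)) (hy1 : ∀ n, 1 ≤ ‖y n‖) {C : ℝ}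
    {M : Set ℕ} (hM : M.Infinite) (hC : ∀ F : Finset ℕ, (F : Set ℕ) ⊆ M → ‖altSum y F‖ ≤ C) :
    HasAntipodal X := by
  obtain ⟨p, hp, hlt⟩ := exists_seq_of_forall_finset_exists
    (fun p : ℕ × ℕ => (p.1 ∈ M ∧ p.2 ∈ M) ∧ p.1 < p.2 ∧ 1 / 2 ≤ ‖y p.1 - y p.2‖)
    (fun p q => p.2 < q.1) (by
      intro s _
      obtain ⟨n, hn⟩ := (infinite_after hM (s.image Prod.snd)).nonempty
      obtain ⟨f, hf, hfn⟩ := exists_dual_vector'' ℝ (y n)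
      obtain ⟨m, ⟨hmM, hmf⟩, hnm⟩ := (((Nat.frequently_atTop_iff_infinite.2 hM).and_eventually
        ((hy f).eventually_lt_const (half_pos one_pos))).and_eventually
          (eventually_gt_atTop n)).exists
      refine ⟨(n, m), ⟨⟨hn.1, hmM⟩, hnm, ?_⟩, fun q hq => hn.2 _ (Finset.mem_image_of_mem _ hq)⟩
      have h1 := (le_abs_self _).trans (abs_apply_le hf (y n - y m))
      rw [map_sub, hfn] at h1
      have h2 := hy1 n
      simp only [RCLike.ofReal_real_eq_id, id_eq] at h1
      linarith)
  have hsum : ∀ I : Finset ℕ, ‖∑ i ∈ I, (y (p i).1 - y (p i).2)‖ ≤ C := by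
    intro I
    obtain ⟨G, hGM, hG⟩ := exists_sum_sub_eq_altSum y (fun n => (hp n).2.1) hlt
      (fun n => (hp n).1) I
    rw [hG]
    exact hC G hGM
  refine HasAntipodal.of_c0 (y := fun n => y (p n).1 - y (p n).2) (K := 2 * C) (half_pos one_pos)
    (fun n => (hp n).2.2) fun a ha => ?_
  obtain ⟨f, hf, hfT⟩ := exists_dual_vector'' ℝ
    (Finsupp.linearCombination ℝ (fun n => y (p n).1 - y (p n).2) a)
  have hfI : ∀ I : Finset ℕ, |∑ i ∈ I, f (y (p i).1 - y (p i).2)| ≤ C := by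
    intro I
    rw [← map_sum]
    exact (abs_apply_le hf _).trans (hsum I)
  rw [RCLike.ofReal_real_eq_id, id_eq] at hfT
  rw [← hfT, Finsupp.linearCombination_apply, Finsupp.sum, map_sum]
  calc ∑ i ∈ a.support, f (a i • (y (p i).1 - y (p i).2))
      ≤ ∑ i ∈ a.support, |f (y (p i).1 - y (p i).2)| := by
        refine Finset.sum_le_sum fun i _ => ?_
        rw [map_smul, smul_eq_mul]
        refine (le_abs_self _).trans ?_
        rw [abs_mul]
        exact mul_le_of_le_one_left (abs_nonneg _) (ha i)
    _ = ∑ i ∈ a.support with 0 ≤ f (y (p i).1 - y (p i).2), f (y (p i).1 - y (p i).2) -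
          ∑ i ∈ a.support with ¬ 0 ≤ f (y (p i).1 - y (p i).2), f (y (p i).1 - y (p i).2) := by
        rw [← Finset.sum_filter_add_sum_filter_not a.support
          fun i => 0 ≤ f (y (p i).1 - y (p i).2), sub_eq_add_neg, ← Finset.sum_neg_distrib]
        congr 1
        · exact Finset.sum_congr rfl fun i hi => abs_of_nonneg (Finset.mem_filter.1 hi).2
        · exact Finset.sum_congr rfl fun i hi => abs_of_neg (not_le.1 (Finset.mem_filter.1 hi).2)
    _ ≤ 2 * C := by
        linarith [(abs_le.1 (hfI (a.support.filter fun i =>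
          0 ≤ f (y (p i).1 - y (p i).2)))).2, (abs_le.1 (hfI (a.support.filter fun i =>
          ¬ 0 ≤ f (y (p i).1 - y (p i).2)))).1]

theorem hasAntipodal_of_not_finiteDimensional (hinf : ¬ FiniteDimensional ℝ X) :
    HasAntipodal X := by
  by_contra hX
  obtain ⟨R, x, hR1, hxR, hx1⟩ := exists_seq_norm_le_one_le_norm_sub (𝕜 := ℝ) hinf
  obtain ⟨φ, hφ, hlim⟩ := exists_weaklyCauchy_subseq hX hxR
  let y : ℕ → X := fun n => x (φ (2 * n)) - x (φ (2 * n + 1))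
  have hy : ∀ f : X →L[ℝ] ℝ, Tendsto (fun n => f (y n)) atTop (𝓝 0) := by
    intro f
    obtain ⟨c, hc⟩ := hlim f
    have h1 : Tendsto (fun n : ℕ => 2 * n) atTop atTop :=
      (strictMono_mul_left_of_pos two_pos).tendsto_atTop
    have h2 : Tendsto (fun n : ℕ => 2 * n + 1) atTop atTop := (tendsto_add_atTop_nat 1).comp h1
    simpa [y] using (hc.comp h1).sub (hc.comp h2)
  have hy1 : ∀ n, 1 ≤ ‖y n‖ := fun n => hx1 (hφ.injective.ne (by omega))
  have hyR : ∀ n, ‖y n‖ ≤ 2 * R := fun n => (norm_sub_le _ _).trans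
    (by linarith [hxR (φ (2 * n)), hxR (φ (2 * n + 1))])
  obtain ⟨M, -, hM, h | h⟩ := exists_galvin {F | 2 * (6 * R) < ‖altSum y F‖} infinite_univ
  · exact hX (HasAntipodal.of_altSum_le hy hy1 hM fun F hF => not_lt.1 (h F hF))
  · obtain ⟨N, hNM, hN, hNb⟩ := exists_altSum_initSeg_le hX hy hyR (c := 6 * R) (by linarith)
      (by linarith) hM
    obtain ⟨k, hk⟩ := h N hNM hN
    exact (hNb k).not_gt hk

end

/-- For every infinite-dimensional Banach space X, K_a(X) > 1: there exist an
infinite subset S of the unit ball and d > 1 such that S is (1,1,d)-b.s.a. -/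
theorem stmt13 {X : Type*} [NormedAddCommGroup X] [NormedSpace ℝ X]
    [CompleteSpace X] (hinf : ¬FiniteDimensional ℝ X) :
    1 < Ka X ∧ ∃ S : Set X, S.Infinite ∧ ∃ d : ℝ, 1 < d ∧ IsBSA X S 1 1 d := by
  have h := hasAntipodal_of_not_finiteDimensional hinf
  exact ⟨h.one_lt_Ka, h⟩
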